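/- arXiv:1908.03139 — 2 statements merged into one kernel-verified Lean document; each statement's English description precedes it below -/
import Mathlib

section
/- Let k be a field and let F ∈ k[X₀,…,X₄] be a homogeneous polynomial of degree 3 defining a smooth cubic threefold in P⁴ over k. If F has a nontrivial zero in some finite field extension K/k with [K:k] = 7, then there exists a finite field extension L/k with [L:k] ∈ {1,2,4,5} in which F has a nontrivial zero. -/
open MvPolynomial

theorem Polynomial.coeff_prod_sum_of_natDegree_le {R ι : Type*} [CommSemiring R] (s : Finset ι)
    (p : ι → Polynomial R) (n : ι → ℕ) (h : ∀ i ∈ s, (p i).natDegree ≤ n i) :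
    (∏ i ∈ s, p i).coeff (∑ i ∈ s, n i) = ∏ i ∈ s, (p i).coeff (n i) := by
  classical
  induction s using Finset.induction_on with
  | empty => simp
  | insert a s ha ih =>
    rw [Finset.forall_mem_insert] at h
    rw [Finset.prod_insert ha, Finset.prod_insert ha, Finset.sum_insert ha,
      Polynomial.coeff_mul_add_eq_of_natDegree_le h.1
        ((Polynomial.natDegree_prod_le _ _).trans (Finset.sum_le_sum h.2)), ih h.2]

theorem MvPolynomial.IsHomogeneous.sum_eq_of_mem_support {R σ : Type*} [CommSemiring R] [Fintype σ]
    {F : MvPolynomial σ R} {n : ℕ} (hF : F.IsHomogeneous n) {m : σ →₀ ℕ} (hm : m ∈ F.support) :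
    ∑ i, m i = n := by
  rw [← hF (mem_support_iff.1 hm), Finsupp.weight_apply, Finsupp.sum_fintype _ _ (by simp)]
  simp

theorem MvPolynomial.natDegree_aeval_le_of_isHomogeneous {R σ : Type*} [CommSemiring R] [Fintype σ]
    {F : MvPolynomial σ R} {n d : ℕ} (hF : F.IsHomogeneous n) {f : σ → Polynomial R}
    (hf : ∀ i, (f i).natDegree ≤ d) : (aeval f F).natDegree ≤ n * d := by
  rw [aeval_def, eval₂_eq']
  refine Polynomial.natDegree_sum_le_of_forall_le _ _ fun m hm ↦ ?_
  rw [Polynomial.algebraMap_eq]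
  refine (Polynomial.natDegree_C_mul_le _ _).trans ((Polynomial.natDegree_prod_le _ _).trans ?_)
  rw [← hF.sum_eq_of_mem_support hm, Finset.sum_mul]
  exact Finset.sum_le_sum fun i _ ↦ Polynomial.natDegree_pow_le_of_le _ (hf i)

theorem MvPolynomial.coeff_aeval_of_isHomogeneous {R σ : Type*} [CommSemiring R] [Fintype σ]
    {F : MvPolynomial σ R} {n d : ℕ} (hF : F.IsHomogeneous n) {f : σ → Polynomial R}
    (hf : ∀ i, (f i).natDegree ≤ d) :
    (aeval f F).coeff (n * d) = aeval (fun i ↦ (f i).coeff d) F := by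
  rw [aeval_def, aeval_def, eval₂_eq', eval₂_eq', Polynomial.finsetSum_coeff]
  refine Finset.sum_congr rfl fun m hm ↦ ?_
  rw [Polynomial.algebraMap_eq, Polynomial.coeff_C_mul, ← hF.sum_eq_of_mem_support hm,
    Finset.sum_mul, Polynomial.coeff_prod_sum_of_natDegree_le _ _ _
      fun i _ ↦ Polynomial.natDegree_pow_le_of_le _ (hf i)]
  simp [Polynomial.coeff_pow_of_natDegree_le (hf _)]

theorem MvPolynomial.aeval_smul_of_isHomogeneous {R A σ : Type*} [CommSemiring R] [CommSemiring A]
    [Algebra R A] [Fintype σ] {F : MvPolynomial σ R} {n : ℕ} (hF : F.IsHomogeneous n) (a : A)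
    (x : σ → A) : aeval (a • x) F = a ^ n * aeval x F := by
  rw [aeval_def, aeval_def, eval₂_eq', eval₂_eq', Finset.mul_sum]
  refine Finset.sum_congr rfl fun m hm ↦ ?_
  simp only [Pi.smul_apply, smul_eq_mul, mul_pow, Finset.prod_mul_distrib,
    Finset.prod_pow_eq_pow_sum, hF.sum_eq_of_mem_support hm]
  ring

theorem Polynomial.exists_irreducible_dvd_natDegree_not_dvd {k : Type*} [Field k] {n : ℕ}
    {g : Polynomial k} (hg : g ≠ 0) (h : ¬ n ∣ g.natDegree) :
    ∃ p, Irreducible p ∧ p ∣ g ∧ ¬ n ∣ p.natDegree := by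
  induction g using WfDvdMonoid.induction_on_irreducible with
  | zero => exact absurd rfl hg
  | unit u hu => simp [Polynomial.natDegree_eq_zero_of_isUnit hu] at h
  | mul a i ha hi ih =>
    by_cases hn : n ∣ i.natDegree
    · rw [Polynomial.natDegree_mul hi.ne_zero ha] at h
      obtain ⟨p, hp, hpa, hpn⟩ := ih ha fun hna ↦ h (dvd_add hn hna)
      exact ⟨p, hp, hpa.mul_left i, hpn⟩
    · exact ⟨i, hi, dvd_mul_right i a, hn⟩

theorem Polynomial.exists_eq_mul_and_sum_mul_eq_one {k ι : Type*} [Field k] [Fintype ι]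
    {f : ι → Polynomial k} (hf : f ≠ 0) :
    ∃ (g : Polynomial k) (e c : ι → Polynomial k),
      g ≠ 0 ∧ (∀ i, f i = g * e i) ∧ ∑ i, c i * e i = 1 := by
  obtain ⟨g, hg⟩ := IsPrincipalIdealRing.principal (Ideal.span (Set.range f))
  rw [Ideal.submodule_span_eq] at hg
  have hdvd (i) : g ∣ f i := by
    rw [← Ideal.mem_span_singleton, ← hg]
    exact Ideal.subset_span ⟨i, rfl⟩
  choose e he using hdvd
  have hg0 : g ≠ 0 := by
    rintro rfl
    exact hf (_root_.funext fun i ↦ by rw [he i, zero_mul, Pi.zero_apply])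
  obtain ⟨c, hc⟩ := Ideal.mem_span_range_iff_exists_fun.1 (hg ▸ Ideal.mem_span_singleton_self g)
  refine ⟨g, e, c, hg0, he, mul_left_cancel₀ hg0 ?_⟩
  rw [mul_one, Finset.mul_sum, ← hc]
  refine Finset.sum_congr rfl fun i _ ↦ ?_
  rw [hc, he i]; ring

theorem exists_zero_of_dvd_aeval_coprime {k : Type u} {ι : Type*} [Field k] [Fintype ι]
    {F : MvPolynomial ι k} (hF : F.IsHomogeneous 3) {q : Polynomial k} (hq : q.natDegree = 7)
    {f c : ι → Polynomial k} (hf : ∀ i, (f i).natDegree ≤ 4) (hfc : ∑ i, c i * f i = 1)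
    (hdvd : q ∣ aeval f F) :
    ∃ (L : Type u) (_ : Field L) (_ : Algebra k L) (_ : FiniteDimensional k L),
      Module.finrank k L ∈ ({1, 2, 4, 5} : Set ℕ) ∧
      ∃ y : ι → L, y ≠ 0 ∧ aeval y F = 0 := by
  have hf0 : ∃ j, f j ≠ 0 := by
    by_contra! h
    simp [h] at hfc
  obtain ⟨j₀, hj₀⟩ := hf0
  obtain ⟨j, -, hj⟩ := Finset.exists_max_image Finset.univ (fun i ↦ (f i).degree)
    ⟨j₀, Finset.mem_univ _⟩
  have hfj : f j ≠ 0 := by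
    intro h
    have := hj j₀ (Finset.mem_univ _)
    simp [h, hj₀] at this
  have hle (i) : (f i).natDegree ≤ (f j).natDegree :=
    Polynomial.natDegree_le_natDegree (hj i (Finset.mem_univ _))
  by_cases hlead : aeval (fun i ↦ (f i).coeff (f j).natDegree) F = 0
  · exact ⟨k, _, _, inferInstance, by simp, _,
      fun h ↦ hfj (Polynomial.leadingCoeff_eq_zero.1 (congrFun h j)), hlead⟩
  rw [← coeff_aeval_of_isHomogeneous hF hle] at hlead
  have hdeg : (aeval f F).natDegree = 3 * (f j).natDegree :=
    le_antisymm (natDegree_aeval_le_of_isHomogeneous hF hle) (Polynomial.le_natDegree_of_ne_zero hlead)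
  have hne : aeval f F ≠ 0 := fun h ↦ by simp [h] at hlead
  obtain ⟨g, hg⟩ := hdvd
  have hq0 : q ≠ 0 := left_ne_zero_of_mul (hg ▸ hne)
  have hg0 : g ≠ 0 := right_ne_zero_of_mul (hg ▸ hne)
  rw [hg, Polynomial.natDegree_mul hq0 hg0, hq] at hdeg
  have := hf j
  obtain ⟨p, hp, hpg, hpn⟩ := Polynomial.exists_irreducible_dvd_natDegree_not_dvd hg0
    (n := 3) (by omega)
  have hp5 := Polynomial.natDegree_le_of_dvd hpg hg0
  have := Fact.mk hp
  have hroot (r : Polynomial k) : Polynomial.aeval (AdjoinRoot.root p) r = AdjoinRoot.mk p r :=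
    AdjoinRoot.aeval_eq r
  refine ⟨AdjoinRoot p, inferInstance, inferInstance,
    (AdjoinRoot.powerBasis hp.ne_zero).finite, ?_,
    fun i ↦ Polynomial.aeval (AdjoinRoot.root p) (f i), ?_, ?_⟩
  · rw [(AdjoinRoot.powerBasis hp.ne_zero).finrank, AdjoinRoot.powerBasis_dim]
    simp only [Set.mem_insert_iff, Set.mem_singleton_iff]
    omega
  · intro h
    have := congrArg (Polynomial.aeval (AdjoinRoot.root p)) hfc
    simp only [map_sum, map_mul, map_one, fun i ↦ congrFun h i, Pi.zero_apply, mul_zero,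
      Finset.sum_const_zero] at this
    exact zero_ne_one this
  · rw [← comp_aeval, AlgHom.comp_apply, hg, hroot, AdjoinRoot.mk_eq_zero]
    exact hpg.mul_left q

theorem Module.Dual.exists_eq_apply_mul {k K : Type*} [Field k] [Field K] [Algebra k K]
    [FiniteDimensional k K] {φ : Module.Dual k K} (hφ : φ ≠ 0) (ψ : Module.Dual k K) :
    ∃ b : K, ∀ y, ψ y = φ (b * y) := by
  have hinj : Function.Injective ((LinearMap.mul k K).compr₂ φ) := by
    rw [injective_iff_map_eq_zero]
    intro b hb
    by_contra hb0
    refine hφ (LinearMap.ext fun y ↦ ?_)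
    simpa [mul_inv_cancel_left₀ hb0] using LinearMap.congr_fun hb (b⁻¹ * y)
  obtain ⟨b, hb⟩ := (LinearMap.injective_iff_surjective_of_finrank_eq_finrank
    (Subspace.dual_finrank_eq (K := k) (V := K)).symm).1 hinj ψ
  exact ⟨b, fun y ↦ by simp [← hb]⟩

theorem Submodule.exists_pair_of_two_le_finrank {k V : Type*} [Field k] [AddCommGroup V]
    [Module k V] [FiniteDimensional k V] {N : Submodule k V} (hN : 2 ≤ Module.finrank k N) :
    ∃ u v : V, u ≠ 0 ∧ (∀ a : k, v ≠ a • u) ∧ u ∈ N ∧ v ∈ N := by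
  obtain ⟨v, hv⟩ := exists_linearIndependent_of_le_finrank hN
  have hv₁ := (linearIndependent_fin2.1 hv).1
  have hv₂ := (linearIndependent_fin2.1 hv).2
  exact ⟨v 1, v 0, fun h ↦ hv₁ (Subtype.ext h), fun a h ↦ hv₂ a (Subtype.ext h.symm),
    (v 1).2, (v 0).2⟩

theorem Module.Dual.exists_pair_of_add_two_le_finrank {k V : Type*} [Field k] [AddCommGroup V]
    [Module k V] [FiniteDimensional k V] {n : ℕ} (h : n + 2 ≤ Module.finrank k V) (x : Fin n → V) :
    ∃ φ ψ : Module.Dual k V,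
      φ ≠ 0 ∧ (∀ a : k, ψ ≠ a • φ) ∧ (∀ i, φ (x i) = 0) ∧ ∀ i, ψ (x i) = 0 := by
  obtain ⟨T, hT⟩ : ∃ T : Module.Dual k V →ₗ[k] (Fin n → k), ∀ φ i, T φ i = φ (x i) :=
    ⟨LinearMap.pi fun i ↦ Module.Dual.eval k V (x i), fun _ _ ↦ rfl⟩
  have hker : 2 ≤ Module.finrank k (LinearMap.ker T) := by
    have h₁ := T.finrank_range_add_finrank_ker
    have h₂ := (LinearMap.range T).finrank_le
    rw [Subspace.dual_finrank_eq] at h₁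
    rw [Module.finrank_fin_fun] at h₂
    omega
  obtain ⟨φ, ψ, hφ, hφψ, hφT, hψT⟩ := Submodule.exists_pair_of_two_le_finrank hker
  refine ⟨φ, ψ, hφ, hφψ, fun i ↦ ?_, fun i ↦ ?_⟩
  · rw [← hT, LinearMap.mem_ker.1 hφT, Pi.zero_apply]
  · rw [← hT, LinearMap.mem_ker.1 hψT, Pi.zero_apply]

theorem exists_mul_mem_span_pow {k K : Type*} [Field k] [Field K] [Algebra k K]
    [FiniteDimensional k K] {n : ℕ} (hdeg : Module.finrank k K = n + 2) (hp : (n + 2).Prime)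
    (x : Fin n → K) :
    ∃ (b m : K) (f : Fin n → Polynomial k), m ≠ 0 ∧ (minpoly k b).natDegree = n + 2 ∧
      ∀ i, (f i).natDegree ≤ n - 1 ∧ Polynomial.aeval b (f i) = m * x i := by
  obtain ⟨φ, ψ, hφ, hφψ, hφx, hψx⟩ := Module.Dual.exists_pair_of_add_two_le_finrank hdeg.ge x
  obtain ⟨b, hb⟩ := Module.Dual.exists_eq_apply_mul hφ ψ
  have hint : IsIntegral k b := Algebra.IsIntegral.isIntegral b
  have hbdeg : (minpoly k b).natDegree = n + 2 := by
    refine ((Nat.dvd_prime hp).1 (hdeg ▸ minpoly.degree_dvd hint)).resolve_left fun h ↦ ?_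
    obtain ⟨a, rfl⟩ := minpoly.natDegree_eq_one_iff.1 h
    exact hφψ a (LinearMap.ext fun y ↦ by
      rw [hb, ← Algebra.smul_def, map_smul, LinearMap.smul_apply])
  have hli : LinearIndependent k fun i : Fin (n + 2) ↦ b ^ (i : ℕ) := by
    have := linearIndependent_pow (K := k) b
    rwa [hbdeg] at this
  let B := basisOfLinearIndependentOfCardEqFinrank hli (by simp [hdeg])
  have hB (i) : B i = b ^ (i : ℕ) := by simp [B]
  have hlast : B.coord (Fin.last (n + 1)) ≠ 0 := fun h ↦ by
    simpa using LinearMap.congr_fun h (B (Fin.last (n + 1)))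
  obtain ⟨m, hm⟩ := Module.Dual.exists_eq_apply_mul hlast φ
  refine ⟨b, m, fun i ↦ ∑ j : Fin n,
    Polynomial.C (B.repr (m * x i) j.castSucc.castSucc) * Polynomial.X ^ (j : ℕ), ?_, hbdeg,
    fun i ↦ ⟨?_, ?_⟩⟩
  · rintro rfl
    exact hφ (LinearMap.ext fun y ↦ by simp [hm])
  · exact Polynomial.natDegree_sum_le_of_forall_le _ _ fun j _ ↦
      (Polynomial.natDegree_C_mul_X_pow_le _ _).trans (by omega)
  · have hz := B.sum_repr (m * x i)
    have h₁ : B.repr (m * x i) (Fin.last (n + 1)) = 0 := by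
      rw [← B.coord_apply, ← hm, hφx]
    have h₂ : B.repr (b * (m * x i)) (Fin.last (n + 1)) = 0 := by
      rw [← B.coord_apply, mul_left_comm, ← hm, ← hb, hψx]
    rw [Fin.sum_univ_castSucc, h₁, zero_smul, add_zero] at hz
    have h₃ : b * (m * x i) = ∑ j : Fin (n + 1), B.repr (m * x i) j.castSucc • B j.succ := by
      conv_lhs => rw [← hz]
      rw [Finset.mul_sum]
      refine Finset.sum_congr rfl fun j _ ↦ ?_
      rw [mul_smul_comm, hB, hB, Fin.val_castSucc, Fin.val_succ, pow_succ']
    have h₄ : B.repr (m * x i) (Fin.last n).castSucc = 0 := by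
      rw [h₃, Fin.sum_univ_castSucc] at h₂
      simpa [Finsupp.single_apply, Fin.ext_iff, Fin.val_succ, (Fin.is_lt _).ne] using h₂
    rw [Fin.sum_univ_castSucc, h₄, zero_smul, add_zero] at hz
    rw [map_sum]
    refine Eq.trans ?_ hz
    refine Finset.sum_congr rfl fun j _ ↦ ?_
    simp [hB, Algebra.smul_def]

/-- **Degree descent on smooth cubic threefolds.**
If a smooth cubic threefold in `P⁴` over a field `k` has a nontrivial zero in a finite
extension of degree 7, then it has a nontrivial zero in a finite extension of degree
1, 2, 4 or 5. -/
theorem closed_points_cubic_threefold {k : Type u} [Field k]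
    (F : MvPolynomial (Fin 5) k) (hF_ne : F ≠ 0) (hF_hom : F.IsHomogeneous 3)
    (hF_smooth : ∀ a : Fin 5 → AlgebraicClosure k,
      aeval a F = 0 → (∀ i : Fin 5, aeval a (pderiv i F) = 0) → a = 0)
    (K : Type v) [Field K] [Algebra k K] [FiniteDimensional k K]
    (hdeg : Module.finrank k K = 7)
    (x : Fin 5 → K) (hx : x ≠ 0) (hFx : aeval x F = 0) :
    ∃ (L : Type u) (_ : Field L) (_ : Algebra k L) (_ : FiniteDimensional k L),
      Module.finrank k L ∈ ({1, 2, 4, 5} : Set ℕ) ∧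
      ∃ y : Fin 5 → L, y ≠ 0 ∧ aeval y F = 0 := by
  obtain ⟨b, m, f, hm, hb, hf⟩ := exists_mul_mem_span_pow hdeg (by norm_num) x
  obtain ⟨j, hj⟩ := Function.ne_iff.1 hx
  have hf0 : f ≠ 0 := by
    rintro rfl
    have := (hf j).2
    simp_all
  obtain ⟨g, e, c, hg, hfe, hce⟩ := Polynomial.exists_eq_mul_and_sum_mul_eq_one hf0
  have hgb : Polynomial.aeval b g ≠ 0 := fun h ↦ by
    have := (hf j).2
    rw [hfe, map_mul, h, zero_mul] at this
    exact mul_ne_zero hm hj this.symm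
  refine exists_zero_of_dvd_aeval_coprime hF_hom hb (f := e) (fun i ↦ ?_) hce (minpoly.dvd k b ?_)
  · by_cases hi : e i = 0
    · simp [hi]
    have := (hf i).1
    rw [hfe, Polynomial.natDegree_mul hg hi] at this
    omega
  · rw [← AlgHom.comp_apply, comp_aeval]
    have he : (fun i ↦ Polynomial.aeval b (e i)) = (m / Polynomial.aeval b g) • x := by
      funext i
      have := (hf i).2
      rw [hfe, map_mul] at this
      rw [Pi.smul_apply, smul_eq_mul, div_mul_eq_mul_div, ← this, mul_div_cancel_left₀ _ hgb]
    rw [he, aeval_smul_of_isHomogeneous hF_hom, hFx, mul_zero]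
end

section
/- Let R be a Henselian local ring with maximal ideal m and residue field κ = R/m, and let A be a smooth R-algebra (i.e., A is finitely presented and formally smooth over R). Then every R-algebra homomorphism φ : A → κ lifts to an R-algebra homomorphism ψ : A → R, in the sense that composing ψ with the quotient map R → κ equals φ. -/
/-- Points of standard étale algebras valued in the residue field of a Henselian local ring lift. -/
theorem Algebra.IsStandardEtale.exists_algHom_lift_residue {P B R : Type*} [CommRing P]
    [CommRing B] [Algebra P B] [Algebra.IsStandardEtale P B] [CommRing R] [HenselianLocalRing R]
    [Algebra P R] (φ : B →ₐ[P] IsLocalRing.ResidueField R) :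
    ∃ ψ : B →ₐ[P] R, (IsScalarTower.toAlgHom P R (IsLocalRing.ResidueField R)).comp ψ = φ := by
  let E : StandardEtalePresentation P B := Classical.ofNonempty
  have hx := E.hasMap.map φ
  obtain ⟨a₀, ha₀⟩ := IsLocalRing.residue_surjective (φ E.x)
  have key (p : Polynomial P) (a : R) : IsLocalRing.residue R (Polynomial.aeval a p) =
      Polynomial.aeval (IsLocalRing.residue R a) p :=
    (Polynomial.aeval_algHom_apply
      (IsScalarTower.toAlgHom P R (IsLocalRing.ResidueField R)) a p).symm
  obtain ⟨a, ha, haa₀⟩ := HenselianLocalRing.is_henselian (E.f.map (algebraMap P R))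
    (E.monic_f.map _) a₀
    (by
      rw [Polynomial.eval_map_algebraMap, ← IsLocalRing.residue_eq_zero_iff, key, ha₀]
      exact hx.1)
    (by
      rw [Polynomial.derivative_map, Polynomial.eval_map_algebraMap,
        ← IsLocalRing.residue_ne_zero_iff_isUnit, key, ha₀]
      exact hx.isUnit_derivative_f.ne_zero)
  have hax : IsLocalRing.residue R a = φ E.x := by
    rw [← ha₀, ← sub_eq_zero, ← map_sub, IsLocalRing.residue_eq_zero_iff]
    exact haa₀
  have hmap : E.HasMap a := by
    refine ⟨by rwa [Polynomial.IsRoot, Polynomial.eval_map_algebraMap] at ha, ?_⟩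
    rw [← IsLocalRing.residue_ne_zero_iff_isUnit, key, hax]
    exact hx.2.ne_zero
  refine ⟨(E.lift a hmap).comp E.equivRing.toAlgHom, E.hom_ext ?_⟩
  simpa using hax

/-- **Lifting points of smooth algebras over Henselian local rings.**
Let `R` be a Henselian local ring with residue field `κ`, and let `A` be a smooth
`R`-algebra (finitely presented and formally smooth). Then every `R`-algebra
homomorphism `A → κ` lifts to an `R`-algebra homomorphism `A → R`. -/
theorem smooth_point_lifts_of_henselian {R : Type u} [CommRing R] [HenselianLocalRing R]
    (A : Type u) [CommRing A] [Algebra R A]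
    (hfp : Algebra.FinitePresentation R A) (hfs : Algebra.FormallySmooth R A)
    (φ : A →ₐ[R] IsLocalRing.ResidueField R) :
    ∃ ψ : A →ₐ[R] R, ∀ a : A, IsLocalRing.residue R (ψ a) = φ a := by
  have : Algebra.Smooth R A := ⟨hfs, hfp⟩
  have : (RingHom.ker φ).IsPrime := RingHom.ker_isPrime φ
  obtain ⟨f, hf, n, _, _, _⟩ :=
    Algebra.IsSmoothAt.exists_isStandardEtale_mvPolynomial (R := R) (p := RingHom.ker φ)
  have hunit : IsUnit (φ f) := (show φ f ≠ 0 from hf).isUnit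
  let φf : Localization.Away f →ₐ[R] IsLocalRing.ResidueField R :=
    IsLocalization.liftAlgHom (M := .powers f) (f := φ) (by
      rintro ⟨_, k, rfl⟩
      simpa using hunit.pow k)
  choose c hc using fun i : Fin n ↦ IsLocalRing.residue_surjective
    (φf (algebraMap (MvPolynomial (Fin n) R) _ (.X i)))
  let ρ : MvPolynomial (Fin n) R →ₐ[R] R := MvPolynomial.aeval c
  let : Algebra (MvPolynomial (Fin n) R) R := ρ.toRingHom.toAlgebra
  have : IsScalarTower R (MvPolynomial (Fin n) R) R := .of_algHom ρ
  have hρ : (IsScalarTower.toAlgHom R R (IsLocalRing.ResidueField R)).comp ρ =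
      φf.comp (IsScalarTower.toAlgHom R (MvPolynomial (Fin n) R) (Localization.Away f)) := by
    ext i
    simpa [ρ] using hc i
  obtain ⟨ψ, hψ⟩ := Algebra.IsStandardEtale.exists_algHom_lift_residue
    (P := MvPolynomial (Fin n) R) (R := R)
    { φf with commutes' := fun p ↦ (DFunLike.congr_fun hρ p).symm }
  refine ⟨(ψ.restrictScalars R).comp (IsScalarTower.toAlgHom R A (Localization.Away f)),
    fun a ↦ ?_⟩
  refine (DFunLike.congr_fun hψ (algebraMap A _ a)).trans ?_
  exact IsLocalization.lift_eq _ a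
end
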